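/- (Balanced partition of unity) Let Δ be a shellable balanced (d−1)-dimensional simplicial complex with coloring c : Δ^(0) → [d], together with a proper embedding into ℝ^{d−1}. Then the stress space S(Δ_{[d−1]}) of the induced subcomplex on the vertices of colors 1,…,d−1 is spanned by the stress spaces of the links of the vertices of color d: the natural map ⊕_{v : c(v)=d} S(Lk_v Δ) → S(Δ_{[d−1]}), given by the inclusions S(Lk_v Δ) ⊆ S(Δ_{[d−1]}), is surjective. -/

import Mathlib

open MvPolynomial

open MvPolynomial

/-- An abstract simplicial complex on the vertex set `Fin n`:
a collection of finite subsets closed under taking subsets. -/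
def IsComplex {n : ℕ} (Δ : Set (Finset (Fin n))) : Prop :=
  ∀ σ ∈ Δ, ∀ τ ⊆ σ, τ ∈ Δ

/-- The vertex set `Δ^(0)` of a simplicial complex. -/
def verts {n : ℕ} (Δ : Set (Finset (Fin n))) : Set (Fin n) := {v | {v} ∈ Δ}

/-- The partial derivative `∂/∂xᵢ` as a linear endomorphism of `ℝ[x₁,…,xₙ]`. -/
noncomputable def pd {n : ℕ} (i : Fin n) : Module.End ℝ (MvPolynomial (Fin n) ℝ) :=
  (pderiv i).toLinearMap

/-- The constant coefficient differential operator `(x^a)^∨ = ∏ᵢ (∂/∂xᵢ)^(aᵢ)`. -/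
noncomputable def monDiff {n : ℕ} (a : Fin n →₀ ℕ) : Module.End ℝ (MvPolynomial (Fin n) ℝ) :=
  ((List.finRange n).map fun i => pd i ^ a i).prod

/-- The stress space `S̃(Δ)`: polynomials annihilated by `q^∨` for every `q` in the
nonface ideal `I_Δ` (equivalently, by `(x^a)^∨` for every monomial generator `x^a` of `I_Δ`). -/
noncomputable def tStress {n : ℕ} (Δ : Set (Finset (Fin n))) :
    Submodule ℝ (MvPolynomial (Fin n) ℝ) :=
  ⨅ a ∈ {a : Fin n →₀ ℕ | a.support ∉ Δ}, LinearMap.ker (monDiff a)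

/-- A linear differential `Σᵢ cᵢ ∂/∂xᵢ`. -/
noncomputable def linDiff {n : ℕ} (c : Fin n → ℝ) : Module.End ℝ (MvPolynomial (Fin n) ℝ) :=
  ∑ i, c i • pd i

/-- The canonical differential `δ = Σᵢ ∂/∂xᵢ`. -/
noncomputable def canDiff (n : ℕ) : Module.End ℝ (MvPolynomial (Fin n) ℝ) :=
  linDiff fun _ => (1 : ℝ)

/-- The coordinate differential `θⱼ = Σᵢ (vᵢ)ⱼ ∂/∂xᵢ` of a geometric simplicial complex. -/
noncomputable def coordDiff {n d : ℕ} (V : Fin n → Fin d → ℝ) (j : Fin d) :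
    Module.End ℝ (MvPolynomial (Fin n) ℝ) :=
  linDiff fun i => V i j

/-- The stress space `S(Δ)` of a geometric simplicial complex with vertex coordinates `V`. -/
noncomputable def stress {n d : ℕ} (V : Fin n → Fin d → ℝ) (Δ : Set (Finset (Fin n))) :
    Submodule ℝ (MvPolynomial (Fin n) ℝ) :=
  tStress Δ ⊓ ⨅ j : Fin d, LinearMap.ker (coordDiff V j)

/-- The degree-`k` graded piece `S_k(Δ)` of the stress space. -/
noncomputable def stressK {n d : ℕ} (V : Fin n → Fin d → ℝ) (Δ : Set (Finset (Fin n)))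
    (k : ℕ) : Submodule ℝ (MvPolynomial (Fin n) ℝ) :=
  stress V Δ ⊓ homogeneousSubmodule (Fin n) ℝ k

/-- A geometric simplicial complex in `ℝ^d` is proper if the coordinates of each face of
dimension `< d` are linearly independent. -/
def IsProper {n d : ℕ} (V : Fin n → Fin d → ℝ) (Δ : Set (Finset (Fin n))) : Prop :=
  ∀ σ ∈ Δ, σ.card ≤ d → LinearIndependent ℝ (fun i : {x // x ∈ σ} => V i.1)

/-- The star of a face. -/
def cStar {n : ℕ} (Δ : Set (Finset (Fin n))) (σ : Finset (Fin n)) : Set (Finset (Fin n)) :=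
  {τ ∈ Δ | σ ∪ τ ∈ Δ}

/-- The star of a vertex. -/
def vStar {n : ℕ} (Δ : Set (Finset (Fin n))) (v : Fin n) : Set (Finset (Fin n)) :=
  cStar Δ {v}

/-- The boundary `∂St_v Δ` of the star of a vertex: faces of the star not containing `v`. -/
def vStarBd {n : ℕ} (Δ : Set (Finset (Fin n))) (v : Fin n) : Set (Finset (Fin n)) :=
  {τ ∈ vStar Δ v | v ∉ τ}

/-- The link of a face. -/
def lk {n : ℕ} (Δ : Set (Finset (Fin n))) (σ : Finset (Fin n)) : Set (Finset (Fin n)) :=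
  {τ | Disjoint σ τ ∧ σ ∪ τ ∈ Δ}

/-- The vertex set `γ^(0)` of the support of a stress `γ`. -/
noncomputable def stressVerts {n : ℕ} (γ : MvPolynomial (Fin n) ℝ) : Finset (Fin n) :=
  γ.support.biUnion fun a => a.support

/-- `g_k = dim S_k − dim S_{k−1}` (with `S_{−1} = 0`). -/
noncomputable def gnum {n d : ℕ} (V : Fin n → Fin d → ℝ) (Δ : Set (Finset (Fin n)))
    (k : ℕ) : ℤ :=
  (Module.finrank ℝ ↥(stressK V Δ k) : ℤ) -
    if k = 0 then 0 else (Module.finrank ℝ ↥(stressK V Δ (k - 1)) : ℤ)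

/-- The homogenizing embedding `ℝ^d → ℝ^d × {1} ⊆ ℝ^{d+1}` applied to vertex coordinates. -/
noncomputable def homV {n d : ℕ} (p : Fin n → Fin d → ℝ) : Fin n → Fin (d + 1) → ℝ :=
  fun i => Fin.snoc (p i) 1

/-- `Δ` is the boundary complex of the simplicial `d`-polytope `conv{p 1, …, p n}`:
the polytope is full-dimensional, every `p i` is a vertex, the faces of `Δ` are exactly the
vertex sets cut out by supporting hyperplanes, and every proper face is a simplex. -/
def IsSimplicialPolytopeBoundary {n d : ℕ} (p : Fin n → Fin d → ℝ)
    (Δ : Set (Finset (Fin n))) : Prop :=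
  affineSpan ℝ (Set.range p) = ⊤ ∧
  (∀ i, p i ∉ convexHull ℝ (p '' {j | j ≠ i})) ∧
  (∀ σ ∈ Δ, AffineIndependent ℝ (fun i : {x // x ∈ σ} => p i.1)) ∧
  (∀ σ : Finset (Fin n), σ ∈ Δ ↔
    ∃ (f : (Fin d → ℝ) →ₗ[ℝ] ℝ) (c : ℝ),
      (∃ i, f (p i) < c) ∧ (∀ i, f (p i) ≤ c) ∧ (∀ i, f (p i) = c ↔ i ∈ σ))

/-- The simplicial boundary operator (with real coefficients), on the free module spanned by
all finite subsets of `Fin n`; the empty set plays the role of the `(−1)`-face, so that the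
associated homology is reduced. -/
noncomputable def bdry {n : ℕ} : (Finset (Fin n) →₀ ℝ) →ₗ[ℝ] (Finset (Fin n) →₀ ℝ) :=
  Finsupp.lsum ℝ fun σ => LinearMap.toSpanSingleton ℝ _
    (∑ i ∈ σ, ((-1 : ℝ) ^ (σ.filter (· < i)).card) • Finsupp.single (σ.erase i) (1 : ℝ))

/-- The space of simplicial `k`-chains of `Δ` (spanned by faces of `Δ` of dimension `k`). -/
noncomputable def chains {n : ℕ} (Δ : Set (Finset (Fin n))) (k : ℤ) :
    Submodule ℝ (Finset (Fin n) →₀ ℝ) :=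
  Finsupp.supported ℝ ℝ {σ | σ ∈ Δ ∧ (σ.card : ℤ) = k + 1}

/-- Reduced simplicial `k`-cycles of `Δ`. -/
noncomputable def cycles {n : ℕ} (Δ : Set (Finset (Fin n))) (k : ℤ) :
    Submodule ℝ (Finset (Fin n) →₀ ℝ) :=
  chains Δ k ⊓ LinearMap.ker bdry

/-- Simplicial `k`-boundaries of `Δ`. -/
noncomputable def bdries {n : ℕ} (Δ : Set (Finset (Fin n))) (k : ℤ) :
    Submodule ℝ (Finset (Fin n) →₀ ℝ) :=
  Submodule.map bdry (chains Δ (k + 1))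

/-- The reduced Betti number `β̃_k(Δ)` (with real coefficients). -/
noncomputable def rBetti {n : ℕ} (Δ : Set (Finset (Fin n))) (k : ℤ) : ℕ :=
  Module.finrank ℝ ↥(cycles Δ k) - Module.finrank ℝ ↥(bdries Δ k)

/-- The induced subcomplex `Δ_W` on a vertex set `W`. -/
def induced {n : ℕ} (Δ : Set (Finset (Fin n))) (W : Finset (Fin n)) : Set (Finset (Fin n)) :=
  {σ ∈ Δ | σ ⊆ W}

/-- The vertex set of the support of a simplicial chain. -/
def chainVerts {n : ℕ} (c : Finset (Fin n) →₀ ℝ) : Finset (Fin n) :=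
  c.support.biUnion id

/-- `Δ` is resolution `k`-chordal: every `k`-cycle `z` admits a resolution, i.e. a
`(k+1)`-chain `c` with `∂c = z` and `c^(0) = z^(0)`. -/
def ResolutionChordal {n : ℕ} (Δ : Set (Finset (Fin n))) (k : ℤ) : Prop :=
  ∀ z ∈ cycles Δ k, ∃ c ∈ chains Δ (k + 1), bdry c = z ∧ chainVerts c = chainVerts z

/-- `(Δ, ω)` is toric `k`-chordal: `ω : S_{k+1}(Δ) → S_k(Δ)` is surjective and
`ω : S_k(Δ) → S_{k−1}(Δ)` is injective. -/
def ToricChordal {n d : ℕ} (V : Fin n → Fin d → ℝ) (Δ : Set (Finset (Fin n)))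
    (ω : Module.End ℝ (MvPolynomial (Fin n) ℝ)) (k : ℕ) : Prop :=
  (∀ γ ∈ stressK V Δ k, ∃ γ' ∈ stressK V Δ (k + 1), ω γ' = γ) ∧
  (∀ γ ∈ stressK V Δ k, ω γ = 0 → γ = 0)

/-- `(Δ, ω)` is weakly toric `k`-chordal: `ω : S_k(St_v Δ) → S_{k−1}(St_v Δ)` is injective
for every vertex `v` of `Δ`. -/
def WeaklyToricChordal {n d : ℕ} (V : Fin n → Fin d → ℝ) (Δ : Set (Finset (Fin n)))
    (ω : Module.End ℝ (MvPolynomial (Fin n) ℝ)) (k : ℕ) : Prop :=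
  ∀ v ∈ verts Δ, ∀ γ ∈ stressK V (vStar Δ v) k, ω γ = 0 → γ = 0

/-- A missing face of `Δ`: a nonface all of whose proper subsets are faces. -/
def IsMissingFace {n : ℕ} (Δ : Set (Finset (Fin n))) (σ : Finset (Fin n)) : Prop :=
  σ ∉ Δ ∧ ∀ τ ⊂ σ, τ ∈ Δ

/-- Representatives of relative `k`-stresses of the relative complex `(Δ', Γ)`:
homogeneous degree-`k` elements of `S̃(Δ')` whose image under each coordinate differential
lies in `S̃(Γ)`.  The relative stress space `S_k(Δ', Γ)` is the quotient of this space by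
(the degree-`k` part of) `S̃(Γ)`. -/
noncomputable def relStressK {n d : ℕ} (V : Fin n → Fin d → ℝ)
    (Δ' Γ : Set (Finset (Fin n))) (k : ℕ) : Submodule ℝ (MvPolynomial (Fin n) ℝ) :=
  tStress Δ' ⊓ homogeneousSubmodule (Fin n) ℝ k ⊓
    ⨅ j : Fin d, (tStress Γ).comap (coordDiff V j)

/-- A shelling of a pure `(d−1)`-dimensional simplicial complex: a linear order on the facets
such that the intersection of each facet with the union of all subsequent facets is a pure
`(d−2)`-dimensional complex or empty. -/
def IsShelling {n : ℕ} (Δ : Set (Finset (Fin n))) (d : ℕ) (L : List (Finset (Fin n))) : Prop :=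
  L.Nodup ∧ (∀ σ, σ ∈ L ↔ σ ∈ Δ ∧ σ.card = d) ∧
  (∀ σ ∈ Δ, ∃ F ∈ L, σ ⊆ F) ∧
  ∀ (i : ℕ) (hi : i < L.length) (τ : Finset (Fin n)), τ ⊆ L.get ⟨i, hi⟩ →
    (∃ (j : ℕ) (hj : j < L.length), i < j ∧ τ ⊆ L.get ⟨j, hj⟩) →
    ∃ ρ, τ ⊆ ρ ∧ ρ ⊆ L.get ⟨i, hi⟩ ∧ ρ.card = d - 1 ∧
      ∃ (j : ℕ) (hj : j < L.length), i < j ∧ ρ ⊆ L.get ⟨j, hj⟩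

/-- The degree-`k` graded piece of the stress space `S̃(Δ)`. -/
noncomputable def tStressK {n : ℕ} (Δ : Set (Finset (Fin n))) (k : ℕ) :
    Submodule ℝ (MvPolynomial (Fin n) ℝ) :=
  tStress Δ ⊓ homogeneousSubmodule (Fin n) ℝ k

/-- A sequence `θ` of linear differentials is regular up to degree `k` on `S̃(Δ)`: each
`θ_j` maps the degree-`(i+1)` part of the common kernel of `θ_1, …, θ_{j−1}` in `S̃(Δ)` onto
the degree-`i` part, for every `i ≤ k`. -/
def RegularUpTo {n : ℕ} (Δ : Set (Finset (Fin n)))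
    (θ : List (Module.End ℝ (MvPolynomial (Fin n) ℝ))) (k : ℕ) : Prop :=
  ∀ j < θ.length, ∀ i ≤ k,
    ∀ γ ∈ tStressK Δ i ⊓ ⨅ l ∈ Finset.range j, LinearMap.ker (θ.getD l 0),
      ∃ γ' ∈ tStressK Δ (i + 1) ⊓ ⨅ l ∈ Finset.range j, LinearMap.ker (θ.getD l 0),
        θ.getD j 0 γ' = γ

/-- `dim Δ + 1`: the maximal cardinality of a face. -/
noncomputable def dim1 {n : ℕ} (Δ : Set (Finset (Fin n))) : ℕ :=
  sSup {m | ∃ σ ∈ Δ, σ.card = m}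

/-- `Δ` is Cohen–Macaulay over `ℝ`: the reduced homology of every face link vanishes below
the expected dimension. -/
def IsCM {n : ℕ} (Δ : Set (Finset (Fin n))) : Prop :=
  ∀ σ ∈ Δ, ∀ i : ℤ, i < (dim1 Δ : ℤ) - 1 - σ.card →
    cycles (lk Δ σ) i ≤ bdries (lk Δ σ) i

/-- `(q, T)` is a triangulation of the simplicial polytope `P = conv{p i}` whose faces contained
in the boundary `∂P` form exactly the boundary complex `Δ` of `P`. -/
def IsTriangulation {n d m : ℕ} (p : Fin n → Fin d → ℝ) (Δ : Set (Finset (Fin n)))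
    (q : Fin m → Fin d → ℝ) (T : Set (Finset (Fin m))) : Prop :=
  IsComplex T ∧
  (∀ σ ∈ T, AffineIndependent ℝ (fun i : {x // x ∈ σ} => q i.1)) ∧
  (∀ σ ∈ T, ∀ τ ∈ T,
    convexHull ℝ (q '' ↑σ) ∩ convexHull ℝ (q '' ↑τ) = convexHull ℝ (q '' ↑(σ ∩ τ))) ∧
  (⋃ σ ∈ T, convexHull ℝ (q '' ↑σ)) = convexHull ℝ (Set.range p) ∧
  {s : Set (Fin d → ℝ) | ∃ σ ∈ T,
      convexHull ℝ (q '' ↑σ) ⊆ frontier (convexHull ℝ (Set.range p)) ∧ s = q '' ↑σ}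
    = {s : Set (Fin d → ℝ) | ∃ σ ∈ Δ, s = p '' ↑σ}

/-- The restriction `Δ_S` of a balanced complex to the set `S` of colors. -/
def colorRestrict {n d : ℕ} (Δ : Set (Finset (Fin n))) (col : Fin n → Fin d)
    (S : Finset (Fin d)) : Set (Finset (Fin n)) :=
  {σ ∈ Δ | ∀ v ∈ σ, col v ∈ S}


theorem coeff_pd' {n : ℕ} (i : Fin n) (p : MvPolynomial (Fin n) ℝ) (a : Fin n →₀ ℕ) :
    coeff a (pderiv i p) = ((a i : ℝ) + 1) * coeff (a + Finsupp.single i 1) p := by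
  induction p using MvPolynomial.induction_on' with
  | add p q hp hq => simp [hp, hq]; ring
  | monomial u r =>
    rw [pderiv_monomial, coeff_monomial, coeff_monomial]
    by_cases h : u = a + Finsupp.single i 1
    · subst h; simp; ring
    · rw [if_neg h]
      by_cases h2 : u - Finsupp.single i 1 = a
      · rw [if_pos h2]
        have : u i = 0 := by
          by_contra h3
          apply h
          rw [← h2, tsub_add_cancel_of_le]
          simpa using Nat.one_le_iff_ne_zero.mpr h3
        simp [this]
      · rw [if_neg h2]; simp

/-- divided power coefficients -/
noncomputable def dc {n : ℕ} (p : MvPolynomial (Fin n) ℝ) (a : Fin n →₀ ℕ) : ℝ :=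
  (∏ i, ((a i).factorial : ℝ)) * coeff a p

theorem fac_ne {n : ℕ} (a : Fin n →₀ ℕ) : (∏ i, ((a i).factorial : ℝ)) ≠ 0 :=
  Finset.prod_ne_zero_iff.mpr fun i _ => by exact_mod_cast Nat.factorial_ne_zero _

theorem dc_inj {n : ℕ} {p q : MvPolynomial (Fin n) ℝ} (h : ∀ a, dc p a = dc q a) : p = q := by
  ext a
  exact mul_left_cancel₀ (fac_ne a) (h a)

theorem dc_add {n : ℕ} (p q : MvPolynomial (Fin n) ℝ) (a) : dc (p + q) a = dc p a + dc q a := by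
  simp [dc, mul_add]

theorem dc_smul {n : ℕ} (c : ℝ) (q : MvPolynomial (Fin n) ℝ) (a) : dc (c • q) a = c * dc q a := by
  simp [dc]; ring

theorem dc_sum {n : ℕ} {ι : Type*} (s : Finset ι) (g : ι → MvPolynomial (Fin n) ℝ) (a) :
    dc (∑ i ∈ s, g i) a = ∑ i ∈ s, dc (g i) a := by
  simp [dc, Finset.mul_sum, coeff_sum]

theorem dc_zero {n : ℕ} (a) : dc (0 : MvPolynomial (Fin n) ℝ) a = 0 := by
  simp [dc]

theorem dc_pd {n : ℕ} (i : Fin n) (p : MvPolynomial (Fin n) ℝ) (a) :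
    dc (pd i p) a = dc p (a + Finsupp.single i 1) := by
  have h : (∏ j, (((a + Finsupp.single i 1 : Fin n →₀ ℕ) j).factorial : ℝ))
      = (∏ j, ((a j).factorial : ℝ)) * ((a i : ℝ) + 1) := by
    rw [← Finset.mul_prod_erase _ _ (Finset.mem_univ i),
      ← Finset.mul_prod_erase _ (fun j => ((a j).factorial : ℝ)) (Finset.mem_univ i)]
    rw [Finset.prod_congr rfl (g := fun j => ((a j).factorial : ℝ))]
    · simp [Nat.factorial_succ]; ring
    · intro j hj
      have : j ≠ i := Finset.ne_of_mem_erase hj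
      simp [Finsupp.single_apply, this.symm]
  change dc (pderiv i p) a = _
  simp only [dc, coeff_pd', h]; ring

theorem dc_pd_pow {n : ℕ} (i : Fin n) (k : ℕ) (p : MvPolynomial (Fin n) ℝ) (a) :
    dc ((pd i ^ k) p) a = dc p (a + Finsupp.single i k) := by
  induction k generalizing p with
  | zero => simp
  | succ k ih =>
    rw [pow_succ, Module.End.mul_apply, ih, dc_pd, add_assoc, ← Finsupp.single_add]

theorem dc_list {n : ℕ} (b : Fin n →₀ ℕ) (l : List (Fin n)) (p : MvPolynomial (Fin n) ℝ) (a) :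
    dc ((l.map fun i => pd i ^ b i).prod p) a
      = dc p (a + (l.map fun i => Finsupp.single i (b i)).sum) := by
  induction l generalizing a with
  | nil => simp
  | cons i l ih =>
    rw [List.map_cons, List.prod_cons, Module.End.mul_apply, dc_pd_pow, ih, List.map_cons,
      List.sum_cons, add_assoc]

theorem dc_monDiff {n : ℕ} (b : Fin n →₀ ℕ) (p : MvPolynomial (Fin n) ℝ) (a) :
    dc (monDiff b p) a = dc p (a + b) := by
  rw [monDiff, dc_list]
  congr 2
  rw [← Fin.sum_univ_def]
  exact Finsupp.univ_sum_single b

/-- supported on `Γ` -/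
def TT {n : ℕ} (Γ : Set (Finset (Fin n))) (f : (Fin n →₀ ℕ) → ℝ) : Prop :=
  ∀ a, a.support ∉ Γ → f a = 0

/-- coordinate differentials on functions -/
noncomputable def DD {n d : ℕ} (V : Fin n → Fin d → ℝ) (j : Fin d) (f : (Fin n →₀ ℕ) → ℝ) :
    (Fin n →₀ ℕ) → ℝ :=
  fun a => ∑ i, V i j * f (a + Finsupp.single i 1)

theorem dc_coordDiff {n d : ℕ} (V : Fin n → Fin d → ℝ) (j : Fin d)
    (p : MvPolynomial (Fin n) ℝ) (a) : dc (coordDiff V j p) a = DD V j (dc p) a := by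
  simp [coordDiff, linDiff, dc_sum, dc_smul, dc_pd, DD, LinearMap.sum_apply]

theorem supp_add {n : ℕ} (a b : Fin n →₀ ℕ) : (a + b).support = a.support ∪ b.support := by
  ext i; simp; tauto

theorem supp_add_single {n : ℕ} (a : Fin n →₀ ℕ) (i : Fin n) :
    (a + Finsupp.single i 1).support = insert i a.support := by
  ext j; by_cases h : j = i <;> simp [h, Finsupp.single_apply, eq_comm]

theorem mem_stress_iff {n d : ℕ} (V : Fin n → Fin d → ℝ) (Γ : Set (Finset (Fin n)))
    (hΓ : IsComplex Γ) (p : MvPolynomial (Fin n) ℝ) :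
    p ∈ stress V Γ ↔ TT Γ (dc p) ∧ ∀ j, DD V j (dc p) = 0 := by
  simp only [stress, tStress, Submodule.mem_inf, Submodule.mem_iInf, LinearMap.mem_ker,
    Set.mem_setOf_eq]
  refine and_congr ⟨fun h a ha => ?_, fun h a ha => ?_⟩
    (forall_congr' fun j => ⟨fun h => ?_, fun h => ?_⟩)
  · have := dc_monDiff a p 0
    rw [h a ha, dc_zero, zero_add] at this
    exact this.symm
  · apply dc_inj
    intro b
    rw [dc_monDiff, dc_zero]
    apply h
    intro h2
    apply ha
    refine hΓ _ h2 _ ?_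
    rw [supp_add]
    exact Finset.subset_union_right
  · funext a
    rw [← dc_coordDiff, h, dc_zero]; rfl
  · apply dc_inj
    intro a
    rw [dc_coordDiff, h, dc_zero]; rfl

theorem exists_trunc {n : ℕ} (N : ℕ) (f : (Fin n →₀ ℕ) → ℝ) :
    ∃ p : MvPolynomial (Fin n) ℝ, ∀ a, dc p a = if a.degree ≤ N then f a else 0 := by
  classical
  refine ⟨∑ a ∈ (Finsupp.finite_of_degree_le (σ := Fin n) N).toFinset,
    monomial a (f a / ∏ i, ((a i).factorial : ℝ)), fun a => ?_⟩
  rw [dc, coeff_sum]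
  simp only [coeff_monomial, Finset.sum_ite_eq', Set.Finite.mem_toFinset, Set.mem_setOf_eq]
  split_ifs
  · exact mul_div_cancel₀ _ (fac_ne a)
  · simp

theorem TT.mono {n : ℕ} {Γ Γ' : Set (Finset (Fin n))} (h : Γ ⊆ Γ') {f} (hf : TT Γ f) : TT Γ' f :=
  fun a ha => hf a fun h' => ha (h h')

theorem TT.add {n : ℕ} {Γ : Set (Finset (Fin n))} {f g} (hf : TT Γ f) (hg : TT Γ g) :
    TT Γ (f + g) := fun a ha => by simp [hf a ha, hg a ha]

theorem TT.sub {n : ℕ} {Γ : Set (Finset (Fin n))} {f g} (hf : TT Γ f) (hg : TT Γ g) :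
    TT Γ (f - g) := fun a ha => by simp [hf a ha, hg a ha]

theorem TT.smul {n : ℕ} {Γ : Set (Finset (Fin n))} {f} (c : ℝ) (hf : TT Γ f) :
    TT Γ (c • f) := fun a ha => by simp [hf a ha]

theorem DD_add {n d : ℕ} (V : Fin n → Fin d → ℝ) (j : Fin d) (f g) :
    DD V j (f + g) = DD V j f + DD V j g := by
  funext a; simp [DD, mul_add, Finset.sum_add_distrib]

theorem DD_sub {n d : ℕ} (V : Fin n → Fin d → ℝ) (j : Fin d) (f g) :
    DD V j (f - g) = DD V j f - DD V j g := by
  funext a; simp [DD, mul_sub, Finset.sum_sub_distrib]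

theorem DD_smul {n d : ℕ} (V : Fin n → Fin d → ℝ) (j : Fin d) (c : ℝ) (f) :
    DD V j (c • f) = c • DD V j f := by
  funext a; simp only [DD, Pi.smul_apply, smul_eq_mul, Finset.mul_sum]
  exact Finset.sum_congr rfl fun _ _ => by ring

theorem DD_comm {n d : ℕ} (V : Fin n → Fin d → ℝ) (j k : Fin d) (f) :
    DD V j (DD V k f) = DD V k (DD V j f) := by
  funext a; simp only [DD, Finset.mul_sum]
  rw [Finset.sum_comm]
  exact Finset.sum_congr rfl fun i _ => Finset.sum_congr rfl fun l _ => by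
    rw [add_right_comm]; ring

theorem TT.DD {n d : ℕ} (V : Fin n → Fin d → ℝ) {Γ : Set (Finset (Fin n))} (hΓ : IsComplex Γ)
    {f} (hf : TT Γ f) (j : Fin d) : TT Γ (DD V j f) := fun a ha => by
  refine Finset.sum_eq_zero fun i _ => ?_
  rw [hf, mul_zero]
  intro h
  refine ha (hΓ _ h _ ?_)
  rw [supp_add_single]; exact Finset.subset_insert _ _

/-- Poincare lemma in degree one -/
def Poinc {n d : ℕ} (V : Fin n → Fin d → ℝ) (Γ : Set (Finset (Fin n))) : Prop :=
  ∀ η : Fin d → (Fin n →₀ ℕ) → ℝ, (∀ j, TT Γ (η j)) →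
    (∀ j k, DD V j (η k) = DD V k (η j)) → ∃ β, TT Γ β ∧ ∀ j, DD V j β = η j

/-- one shelling step -/
structure Step {n : ℕ} (Γ' Γ : Set (Finset (Fin n))) (R G : Finset (Fin n)) : Prop where
  sub : R ⊆ G
  cplx' : IsComplex Γ'
  cplx : IsComplex Γ
  mem : ∀ τ, τ ∈ Γ ↔ τ ∈ Γ' ∨ (R ⊆ τ ∧ τ ⊆ G)
  disj : ∀ τ ∈ Γ', ¬ R ⊆ τ

theorem Step.TT' {n : ℕ} {Γ' Γ : Set (Finset (Fin n))} {R G} (h : Step Γ' Γ R G) {f}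
    (hf : TT Γ f) (h0 : ∀ a : Fin n →₀ ℕ, R ⊆ a.support → a.support ⊆ G → f a = 0) :
    TT Γ' f := fun a ha => by
  by_cases h1 : a.support ∈ Γ
  · rcases (h.mem _).1 h1 with h2 | h2
    · exact (ha h2).elim
    · exact h0 a h2.1 h2.2
  · exact hf a h1

/-- dual basis -/
theorem exists_dual {n d : ℕ} (V : Fin n → Fin d → ℝ) (G : Finset (Fin n)) (hG : G.card = d)
    (hV : LinearIndependent ℝ (fun i : {x // x ∈ G} => V i.1)) :
    ∃ c : Fin n → Fin d → ℝ,
      (∀ i ∈ G, ∀ k ∈ G, ∑ j, c i j * V k j = if i = k then 1 else 0) ∧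
      (∀ j k, ∑ i ∈ G, V i j * c i k = if j = k then 1 else 0) := by
  classical
  rcases isEmpty_or_nonempty {x // x ∈ G} with hE | hE
  · have : G = ∅ := by
      ext x; simp; intro hx; exact hE.elim ⟨x, hx⟩
    subst this
    simp at hG; subst hG
    exact ⟨fun _ _ => 0, by simp, fun j => j.elim0⟩
  let b := basisOfLinearIndependentOfCardEqFinrank hV (by simp [hG])
  have hb : ∀ i, b i = V i.1 := fun i => by simp [b]
  refine ⟨fun i k => if h : i ∈ G then b.repr (Pi.single k 1) ⟨i, h⟩ else 0, ?_, ?_⟩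
  · intro i hi k hk
    have h1 : b.repr (V k) ⟨i, hi⟩ = if i = k then 1 else 0 := by
      rw [← hb ⟨k, hk⟩, b.repr_self, Finsupp.single_apply]
      simp [eq_comm]
    rw [← h1]
    have h2 : V k = ∑ j, V k j • (Pi.single j 1 : Fin d → ℝ) := by
      funext l
      simp [Finset.sum_apply, Pi.single_apply]
    conv_rhs => rw [h2]
    simp only [hi, dif_pos, map_sum, map_smul, Finsupp.coe_finset_sum, Finset.sum_apply,
      Finsupp.smul_apply, smul_eq_mul]
    exact Finset.sum_congr rfl fun j _ => mul_comm _ _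
  · intro j k
    have h1 := congrFun (b.sum_repr (Pi.single k 1)) j
    rw [Finset.sum_apply] at h1
    rw [← Finset.sum_attach]
    simp only [Pi.smul_apply, smul_eq_mul, hb] at h1
    rw [Pi.single_apply] at h1
    rw [← h1]
    exact Finset.sum_congr rfl fun i _ => by simp [i.2, mul_comm]

/-- key evaluation -/
theorem Step.eval {n d : ℕ} (V : Fin n → Fin d → ℝ) {Γ' Γ : Set (Finset (Fin n))} {R G}
    (h : Step Γ' Γ R G) {f} (hf : TT Γ f) (j : Fin d) (a : Fin n →₀ ℕ) (h1 : R ⊆ a.support) :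
    DD V j f a = ∑ i ∈ G, V i j * f (a + Finsupp.single i 1) := by
  rw [DD]
  symm
  refine Finset.sum_subset (Finset.subset_univ _) fun i _ hi => ?_
  rw [hf, mul_zero]
  rw [supp_add_single, h.mem]
  rintro (h2 | h2)
  · exact h.disj _ h2 (h1.trans (Finset.subset_insert _ _))
  · exact hi (h2.2 (Finset.mem_insert_self _ _))

/-- indicator exponent -/
noncomputable def ind {n : ℕ} (R : Finset (Fin n)) : Fin n →₀ ℕ :=
  Finsupp.equivFunOnFinite.symm fun i => if i ∈ R then 1 else 0

theorem ind_apply {n : ℕ} (R : Finset (Fin n)) (i) : ind R i = if i ∈ R then 1 else 0 := rfl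

theorem ind_supp {n : ℕ} (R : Finset (Fin n)) : (ind R).support = R := by
  ext i; simp [ind_apply]

theorem exists_pred {n : ℕ} {R : Finset (Fin n)} {a : Fin n →₀ ℕ} (h : R ⊆ a.support)
    (hne : a ≠ ind R) :
    ∃ i ∈ a.support, ∃ b : Fin n →₀ ℕ, R ⊆ b.support ∧ b.support ⊆ a.support ∧
      a = b + Finsupp.single i 1 := by
  obtain ⟨i, hi⟩ : ∃ i, a i ≠ ind R i := by
    by_contra hc; push Not at hc; exact hne (Finsupp.ext hc)
  rw [ind_apply] at hi
  have hR : i ∈ R → 1 < a i := fun h1 => by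
    have := h h1
    simp [h1] at this hi
    omega
  have h0 : a i ≠ 0 := by
    by_cases h1 : i ∈ R
    · have := hR h1; omega
    · simpa [h1] using hi
  have hab : a = (a - Finsupp.single i 1) + Finsupp.single i 1 := by
    rw [tsub_add_cancel_of_le]
    simpa using Nat.one_le_iff_ne_zero.mpr h0
  refine ⟨i, by simpa using h0, a - Finsupp.single i 1, fun j hj => ?_, ?_, hab⟩
  · have := h hj
    by_cases hji : j = i
    · subst hji; have := hR hj; simp; omega
    · simpa [Finsupp.single_apply, Ne.symm hji] using this
  · conv_rhs => rw [hab]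
    rw [supp_add]; exact Finset.subset_union_left

theorem Step.theta {n d : ℕ} (V : Fin n → Fin d → ℝ) {Γ' Γ : Set (Finset (Fin n))} {R G}
    (h : Step Γ' Γ R G) {c : Fin n → Fin d → ℝ}
    (hc : ∀ i ∈ G, ∀ k ∈ G, ∑ j, c i j * V k j = if i = k then 1 else 0)
    {f} (hf : TT Γ f) (a : Fin n →₀ ℕ) (h1 : R ⊆ a.support) {i} (hi : i ∈ G) :
    ∑ j, c i j * DD V j f a = f (a + Finsupp.single i 1) := by
  simp only [h.eval V hf _ a h1, Finset.mul_sum]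
  rw [Finset.sum_comm]
  have : ∀ k ∈ G, ∑ j, c i j * (V k j * f (a + Finsupp.single k 1))
      = if i = k then f (a + Finsupp.single k 1) else 0 := fun k hk => by
    simp only [← mul_assoc, ← Finset.sum_mul, hc i hi k hk]
    simp
  rw [Finset.sum_congr rfl this]
  simp [hi]

theorem Step.uniq {n d : ℕ} (V : Fin n → Fin d → ℝ) {Γ' Γ : Set (Finset (Fin n))} {R G}
    (h : Step Γ' Γ R G) (hG : G.card = d)
    (hV : LinearIndependent ℝ (fun i : {x // x ∈ G} => V i.1))
    {f} (hf : TT Γ f) (hD : ∀ j, DD V j f = 0) (h0 : f (ind R) = 0) : TT Γ' f := by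
  obtain ⟨c, hc, -⟩ := exists_dual V G hG hV
  refine h.TT' hf fun a h1 h2 => ?_
  by_cases ha : a = ind R
  · rw [ha, h0]
  obtain ⟨i, hi, b, hb1, hb2, rfl⟩ := exists_pred h1 ha
  rw [← h.theta V hc hf b hb1 (h2 hi)]
  simp [hD]

theorem Step.correct {n d : ℕ} {V : Fin n → Fin d → ℝ} {Γ' Γ : Set (Finset (Fin n))} {R G}
    (h : Step Γ' Γ R G) (hP : Poinc V Γ') (η : Fin d → (Fin n →₀ ℕ) → ℝ)
    (hη : ∀ j, TT Γ (η j)) (hcl : ∀ j k, DD V j (η k) = DD V k (η j))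
    {f} (hf : TT Γ f)
    (h0 : ∀ j, ∀ a : Fin n →₀ ℕ, R ⊆ a.support → a.support ⊆ G → DD V j f a = η j a) :
    ∃ β, TT Γ' β ∧ ∀ j, DD V j (f + β) = η j := by
  obtain ⟨β, hβ, hβ2⟩ := hP (fun j => η j - DD V j f)
    (fun j => h.TT' ((hη j).sub (hf.DD V h.cplx j)) fun a h1 h2 => by simp [h0 j a h1 h2])
    (fun j k => by rw [DD_sub, DD_sub, hcl, DD_comm])
  exact ⟨β, hβ, fun j => by rw [DD_add, hβ2]; simp⟩

theorem Step.poinc {n d : ℕ} (V : Fin n → Fin d → ℝ) {Γ' Γ : Set (Finset (Fin n))} {R G}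
    (h : Step Γ' Γ R G) (hG : G.card = d)
    (hV : LinearIndependent ℝ (fun i : {x // x ∈ G} => V i.1)) (hP : Poinc V Γ') :
    Poinc V Γ := by
  classical
  intro η hη hcl
  obtain ⟨c, hc, hc2⟩ := exists_dual V G hG hV
  let θ : Fin n → (Fin n →₀ ℕ) → ℝ := fun i a => ∑ j, c i j * η j a
  have hθ : ∀ b : Fin n →₀ ℕ, R ⊆ b.support → ∀ p ∈ G, ∀ q ∈ G,
      θ q (b + Finsupp.single p 1) = θ p (b + Finsupp.single q 1) := by
    intro b hb p hp q hq
    simp only [θ]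
    have e1 : ∀ p ∈ G, ∀ k, η k (b + Finsupp.single p 1) = ∑ j, c p j * DD V j (η k) b :=
      fun p hp k => (h.theta V hc (hη k) b hb hp).symm
    simp only [e1 p hp, e1 q hq, Finset.mul_sum]
    rw [Finset.sum_comm]
    refine Finset.sum_congr rfl fun j _ => Finset.sum_congr rfl fun k _ => ?_
    rw [hcl j k]; ring
  let Q : (Fin n →₀ ℕ) → Fin n × (Fin n →₀ ℕ) → Prop := fun a ib =>
    ib.1 ∈ G ∧ R ⊆ ib.2.support ∧ ib.2.support ⊆ G ∧ a = ib.2 + Finsupp.single ib.1 1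
  let f : (Fin n →₀ ℕ) → ℝ := fun a =>
    if hx : ∃ ib, Q a ib then θ hx.choose.1 hx.choose.2 else 0
  have hfe : ∀ b : Fin n →₀ ℕ, R ⊆ b.support → b.support ⊆ G → ∀ i ∈ G,
      f (b + Finsupp.single i 1) = θ i b := by
    intro b hb1 hb2 i hi
    have hx : ∃ ib, Q (b + Finsupp.single i 1) ib := ⟨(i, b), hi, hb1, hb2, rfl⟩
    simp only [f, dif_pos hx]
    obtain ⟨g1, g2, g3, g4⟩ := hx.choose_spec
    generalize hx.choose = ib at *
    obtain ⟨k, b'⟩ := ib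
    simp only at *
    by_cases hik : i = k
    · subst hik
      rw [add_right_cancel g4]
    · -- common predecessor
      have hv : ∀ j, b j + (if i = j then 1 else 0) = b' j + (if k = j then 1 else 0) := fun j => by
        have := DFunLike.congr_fun g4 j
        simpa [Finsupp.single_apply] using this
      have e1 : b = (b - Finsupp.single k 1) + Finsupp.single k 1 := by
        rw [tsub_add_cancel_of_le]
        have := hv k
        simp [hik] at this
        simp; omega
      have e2 : b' = (b - Finsupp.single k 1) + Finsupp.single i 1 := by
        apply add_right_cancel (b := Finsupp.single k 1)
        rw [add_right_comm, ← e1, g4]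
      have hs : R ⊆ (b - Finsupp.single k 1).support := by
        intro j hj
        have u1 := hb1 hj
        have u2 := g2 hj
        have := hv j
        by_cases hjk : k = j
        · subst hjk
          simp [hik] at this u1 u2 ⊢
          omega
        · simpa [Finsupp.single_apply, hjk] using u1
      rw [e2]
      conv_rhs => rw [e1]
      exact hθ _ hs _ hi _ g1
  have hf : TT Γ f := by
    intro a ha
    simp only [f]
    rw [dif_neg]
    rintro ⟨⟨i, b⟩, g1, g2, g3, g4⟩
    simp only at *
    apply ha
    rw [h.mem, g4, supp_add_single]
    exact Or.inr ⟨g2.trans (Finset.subset_insert _ _), Finset.insert_subset g1 g3⟩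
  obtain ⟨β, hβ, hβ2⟩ := h.correct hP η hη hcl hf fun j a h1 h2 => by
    rw [h.eval V hf j a h1]
    rw [Finset.sum_congr rfl fun i hi => by rw [hfe a h1 h2 i hi]]
    simp only [θ, Finset.mul_sum]
    rw [Finset.sum_comm]
    have : ∀ k, ∑ i ∈ G, V i j * (c i k * η k a) = if j = k then η k a else 0 := fun k => by
      simp only [← mul_assoc, ← Finset.sum_mul, hc2 j k]; simp
    simp [this]
  exact ⟨f + β, hf.add (hβ.mono fun τ hτ => (h.mem τ).2 (Or.inl hτ)), hβ2⟩

theorem Step.ext {n d : ℕ} (V : Fin n → Fin d → ℝ) {Γ' Γ : Set (Finset (Fin n))} {R G}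
    (h : Step Γ' Γ R G) (hP : Poinc V Γ') :
    ∃ f, TT Γ f ∧ (∀ j, DD V j f = 0) ∧ f (ind R) = 1 := by
  classical
  let f : (Fin n →₀ ℕ) → ℝ := fun a => if a = ind R then 1 else 0
  have hf : TT Γ f := by
    intro a ha
    refine if_neg ?_
    rintro rfl
    rw [ind_supp] at ha
    exact ha ((h.mem _).2 (Or.inr ⟨subset_rfl, h.sub⟩))
  obtain ⟨β, hβ, hβ2⟩ := h.correct hP (fun _ => 0) (fun j a _ => rfl) (fun _ _ => by
      funext a; simp [DD]) hf fun j a h1 h2 => by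
    refine Finset.sum_eq_zero fun i _ => ?_
    simp only [f]
    rw [if_neg, mul_zero]
    intro he
    have := DFunLike.congr_fun he i
    simp only [Finsupp.add_apply, Finsupp.single_eq_same, ind_apply] at this
    split_ifs at this with hi
    · have := h1 hi
      simp at this
      omega
  refine ⟨f + β, hf.add (hβ.mono fun τ hτ => (h.mem τ).2 (Or.inl hτ)), hβ2, ?_⟩
  have : β (ind R) = 0 := hβ _ fun h' => h.disj _ h' (by rw [ind_supp])
  simp [this, f]

/-- complex generated by a list of facets -/
def gen {n : ℕ} (L : List (Finset (Fin n))) : Set (Finset (Fin n)) := {σ | ∃ F ∈ L, σ ⊆ F}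

/-- recursive shelling condition -/
def Sh {n : ℕ} (d : ℕ) : List (Finset (Fin n)) → Prop
  | [] => True
  | F :: L => (∀ τ ⊆ F, τ ∈ gen L → ∃ ρ, τ ⊆ ρ ∧ ρ ⊆ F ∧ ρ.card = d ∧ ρ ∈ gen L) ∧ Sh d L

/-- colour restriction -/
def cr {n d : ℕ} (col : Fin n → Fin (d + 1)) (Δ : Set (Finset (Fin n))) :
    Set (Finset (Fin n)) := {σ ∈ Δ | ∀ v ∈ σ, col v ≠ Fin.last d}

theorem gen_cplx {n : ℕ} (L : List (Finset (Fin n))) : IsComplex (gen L) :=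
  fun _ ⟨F, hF, h⟩ _ ht => ⟨F, hF, ht.trans h⟩

theorem cr_cplx {n d : ℕ} (col : Fin n → Fin (d + 1)) {Δ : Set (Finset (Fin n))}
    (h : IsComplex Δ) : IsComplex (cr col Δ) :=
  fun _ hσ _ ht => ⟨h _ hσ.1 _ ht, fun v hv => hσ.2 v (ht hv)⟩

theorem lk_cplx {n : ℕ} {Δ : Set (Finset (Fin n))} (h : IsComplex Δ) (s) :
    IsComplex (lk Δ s) :=
  fun _ hσ _ ht => ⟨hσ.1.mono_right ht, h _ hσ.2 _ (Finset.union_subset_union_right ht)⟩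

theorem lk_mono {n : ℕ} {Δ Δ' : Set (Finset (Fin n))} (h : Δ ⊆ Δ') (s) : lk Δ s ⊆ lk Δ' s :=
  fun _ hσ => ⟨hσ.1, h hσ.2⟩

theorem main_ind {n d : ℕ} (V : Fin n → Fin d → ℝ) (col : Fin n → Fin (d + 1))
    (L : List (Finset (Fin n))) (hcard : ∀ F ∈ L, F.card = d + 1)
    (hcol : ∀ F ∈ L, Set.InjOn col ↑F) (hsh : Sh d L)
    (hp : ∀ F ∈ L, ∀ G ⊆ F, G.card = d → LinearIndependent ℝ (fun i : {x // x ∈ G} => V i.1)) :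
    (∀ w, col w = Fin.last d → Poinc V (lk (gen L) {w})) ∧
    (∀ f, TT (cr col (gen L)) f → (∀ j, DD V j f = 0) →
      ∃ g : Fin n → (Fin n →₀ ℕ) → ℝ, (∀ v, TT (lk (gen L) {v}) (g v)) ∧
        (∀ v j, DD V j (g v) = 0) ∧ (∀ v, col v ≠ Fin.last d → g v = 0) ∧ ∑ v, g v = f) := by
  classical
  induction L with
  | nil =>
    refine ⟨fun w _ η hη _ => ⟨0, fun _ _ => rfl, fun j => ?_⟩, fun f hf _ => ?_⟩
    · funext a
      rw [hη j a]
      · simp [DD]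
      · simp [lk, gen]
    · refine ⟨fun _ => 0, fun _ _ _ => rfl, fun v j => by funext a; simp [DD], fun _ _ => rfl, ?_⟩
      funext a
      rw [hf a]
      · simp
      · simp [cr, gen]
  | cons F L ih =>
    obtain ⟨ih1, ih2⟩ := ih (fun F hF => hcard F (List.mem_cons_of_mem _ hF))
      (fun F hF => hcol F (List.mem_cons_of_mem _ hF)) hsh.2
      (fun F hF => hp F (List.mem_cons_of_mem _ hF))
    have hFm : F ∈ F :: L := List.mem_cons_self
    have hFc := hcard F hFm
    have hFi := hcol F hFm
    have hsub : gen L ⊆ gen (F :: L) := fun σ ⟨F', h1, h2⟩ => ⟨F', List.mem_cons_of_mem _ h1, h2⟩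
    have hgen : ∀ σ, σ ∈ gen (F :: L) ↔ σ ∈ gen L ∨ σ ⊆ F := fun σ => by
      simp [gen, or_comm]
    have hR : ∃ R ⊆ F, ∀ τ ⊆ F, (τ ∈ gen L ↔ ¬ R ⊆ τ) := by
      refine ⟨F.filter fun v => F.erase v ∈ gen L, Finset.filter_subset _ _,
        fun τ hτ => ⟨fun h1 h2 => ?_, fun h1 => ?_⟩⟩
      · obtain ⟨ρ, r1, r2, r3, r4⟩ := hsh.1 τ hτ h1
        obtain ⟨v, hv⟩ : ∃ v, v ∈ F \ ρ := by
          rw [← Finset.Nonempty, ← Finset.card_pos, Finset.card_sdiff_of_subset r2]; omega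
        rw [Finset.mem_sdiff] at hv
        have hρ : ρ = F.erase v := by
          apply Finset.eq_of_subset_of_card_le
          · exact fun x hx => Finset.mem_erase.2 ⟨fun e => hv.2 (e ▸ hx), r2 hx⟩
          · rw [Finset.card_erase_of_mem hv.1]; omega
        exact hv.2 (r1 (h2 (Finset.mem_filter.2 ⟨hv.1, hρ ▸ r4⟩)))
      · obtain ⟨v, hv, hv2⟩ := Finset.not_subset.1 h1
        rw [Finset.mem_filter] at hv
        exact gen_cplx L _ hv.2 _ fun x hx => Finset.mem_erase.2 ⟨fun e => hv2 (e ▸ hx), hτ hx⟩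
    obtain ⟨R, hRF, hR⟩ := hR
    have hRn : ∀ τ ∈ gen L, ¬ R ⊆ τ := fun τ hτ h =>
      (hR R hRF).1 (gen_cplx L _ hτ _ h) subset_rfl
    obtain ⟨w, hwF, hw⟩ : ∃ w ∈ F, col w = Fin.last d := by
      have : F.image col = Finset.univ := by
        apply Finset.eq_univ_of_card
        rw [Finset.card_image_of_injOn hFi, hFc]; simp
      have h := Finset.mem_univ (Fin.last d)
      rw [← this, Finset.mem_image] at h
      exact h
    have hwu : ∀ v ∈ F, col v = Fin.last d → v = w := fun v hv h =>
      hFi hv hwF (h.trans hw.symm)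
    have hGc : (F.erase w).card = d := by rw [Finset.card_erase_of_mem hwF]; omega
    have hGV := hp F hFm _ (Finset.erase_subset w F) hGc
    have hstepL : Step (lk (gen L) {w}) (lk (gen (F :: L)) {w}) (R.erase w) (F.erase w) := by
      refine ⟨Finset.erase_subset_erase _ hRF, lk_cplx (gen_cplx _) _, lk_cplx (gen_cplx _) _,
        fun τ => ?_, fun τ hτ h => ?_⟩
      · constructor
        · rintro ⟨t1, t2⟩
          rw [Finset.disjoint_singleton_left] at t1
          by_cases t3 : {w} ∪ τ ∈ gen L
          · exact Or.inl ⟨Finset.disjoint_singleton_left.2 t1, t3⟩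
          · have t4 := ((hgen _).1 t2).resolve_left t3
            rw [hR _ t4, not_not] at t3
            refine Or.inr ⟨fun x hx => ?_, fun x hx => ?_⟩
            · have hx' := Finset.mem_erase.1 hx
              have := t3 hx'.2
              simp [hx'.1] at this
              exact this
            · exact Finset.mem_erase.2 ⟨fun e => t1 (e ▸ hx), t4 (Finset.mem_union_right _ hx)⟩
        · rintro (t | ⟨t1, t2⟩)
          · exact lk_mono hsub _ t
          · refine ⟨Finset.disjoint_singleton_left.2 fun h => by simpa using t2 h,
              (hgen _).2 (Or.inr ?_)⟩
            exact Finset.union_subset (by simpa using hwF) (t2.trans (Finset.erase_subset _ _))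
      · refine hRn _ hτ.2 fun x hx => ?_
        by_cases hxw : x = w
        · simp [hxw]
        · exact Finset.mem_union_right _ (h (Finset.mem_erase.2 ⟨hxw, hx⟩))
    refine ⟨fun v hv => ?_, fun f hf hD => ?_⟩
    · by_cases hvw : v = w
      · subst hvw
        exact hstepL.poinc V hGc hGV (ih1 v hv)
      · have : lk (gen (F :: L)) {v} = lk (gen L) {v} := by
          refine Set.Subset.antisymm (fun τ hτ => ?_) (lk_mono hsub _)
          exact ⟨hτ.1, ((hgen _).1 hτ.2).resolve_right fun h => hvw (hwu v (h (by simp)) hv)⟩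
        rw [this]
        exact ih1 v hv
    · by_cases hwR : w ∈ R
      · obtain ⟨g, g1, g2, g3, g4⟩ := ih2 f (hf.mono fun σ hσ => by
          refine ⟨?_, hσ.2⟩
          rcases (hgen σ).1 hσ.1 with h | h
          · exact h
          · exact (hR σ h).2 fun h' => hσ.2 w (h' hwR) hw) hD
        exact ⟨g, fun v => (g1 v).mono (lk_mono hsub _), g2, g3, g4⟩
      · rw [Finset.erase_eq_of_notMem hwR] at hstepL
        obtain ⟨e, e1, e2, e3⟩ := hstepL.ext V (ih1 w hw)
        have hstep : Step (cr col (gen L)) (cr col (gen (F :: L))) R (F.erase w) := by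
          refine ⟨hstepL.sub, cr_cplx _ (gen_cplx _), cr_cplx _ (gen_cplx _), fun τ => ?_,
            fun τ hτ => hRn _ hτ.1⟩
          constructor
          · rintro ⟨t1, t2⟩
            by_cases t3 : τ ∈ gen L
            · exact Or.inl ⟨t3, t2⟩
            · have t4 := ((hgen _).1 t1).resolve_left t3
              rw [hR _ t4, not_not] at t3
              exact Or.inr ⟨t3, fun x hx =>
                Finset.mem_erase.2 ⟨fun e => t2 x hx (e ▸ hw), t4 hx⟩⟩
          · rintro (t | ⟨t1, t2⟩)
            · exact ⟨hsub t.1, t.2⟩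
            · refine ⟨(hgen _).2 (Or.inr (t2.trans (Finset.erase_subset _ _))), fun v hv h => ?_⟩
              have := Finset.mem_erase.1 (t2 hv)
              exact this.1 (hwu v this.2 h)
        have he : TT (cr col (gen (F :: L))) e := by
          refine e1.mono fun τ hτ => ?_
          refine ⟨gen_cplx _ _ hτ.2 _ Finset.subset_union_right, fun v hv h => ?_⟩
          obtain ⟨F', f1, f2⟩ := hτ.2
          have := hcol F' f1 (f2 (Finset.mem_union_right _ hv))
            (f2 (Finset.mem_union_left _ (Finset.mem_singleton_self w))) (h.trans hw.symm)
          subst this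
          exact Finset.disjoint_singleton_left.1 hτ.1 hv
        have hD' : ∀ j, DD V j (f - f (ind R) • e) = 0 := fun j => by
          rw [DD_sub, DD_smul, hD, e2]; simp
        obtain ⟨g, g1, g2, g3, g4⟩ := ih2 (f - f (ind R) • e)
          (hstep.uniq V hGc hGV (hf.sub (he.smul _)) hD' (by simp [e3])) hD'
        refine ⟨fun v => g v + if v = w then f (ind R) • e else 0, fun v => ?_, fun v j => ?_,
          fun v hv => ?_, ?_⟩
        · refine ((g1 v).mono (lk_mono hsub _)).add ?_
          split_ifs with hv
          · subst hv; exact e1.smul _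
          · exact fun _ _ => rfl
        · rw [DD_add, g2, zero_add]
          split_ifs
          · rw [DD_smul, e2, smul_zero]
          · funext a; simp [DD]
        · beta_reduce
          rw [g3 v hv, if_neg, add_zero]
          rintro rfl; exact hv hw
        · rw [Finset.sum_add_distrib, g4]; simp

theorem sh_of {n d : ℕ} (L : List (Finset (Fin n)))
    (h : ∀ (i : ℕ) (hi : i < L.length) (τ : Finset (Fin n)), τ ⊆ L.get ⟨i, hi⟩ →
    (∃ (j : ℕ) (hj : j < L.length), i < j ∧ τ ⊆ L.get ⟨j, hj⟩) →
    ∃ ρ, τ ⊆ ρ ∧ ρ ⊆ L.get ⟨i, hi⟩ ∧ ρ.card = d + 1 - 1 ∧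
      ∃ (j : ℕ) (hj : j < L.length), i < j ∧ ρ ⊆ L.get ⟨j, hj⟩) : Sh d L := by
  induction L with
  | nil => trivial
  | cons F L ih =>
    refine ⟨fun τ hτ ⟨F', h1, h2⟩ => ?_, ih fun i hi τ hτ ⟨j, hj, hij, hjt⟩ => ?_⟩
    · obtain ⟨j, hj, rfl⟩ := List.getElem_of_mem h1
      obtain ⟨ρ, r1, r2, r3, k, hk, hk0, hk2⟩ := h 0 (by simp) τ hτ
        ⟨j + 1, by simpa using hj, by omega, by simpa using h2⟩
      refine ⟨ρ, r1, r2, r3, ?_⟩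
      obtain ⟨k, rfl⟩ : ∃ k', k = k' + 1 := ⟨k - 1, by omega⟩
      exact ⟨L[k]'(by simpa using hk), List.getElem_mem _, by simpa using hk2⟩
    · obtain ⟨ρ, r1, r2, r3, k, hk, hk0, hk2⟩ := h (i + 1) (by simpa using hi) τ
        (by simpa using hτ) ⟨j + 1, by simpa using hj, by omega, by simpa using hjt⟩
      obtain ⟨k, rfl⟩ : ∃ k', k = k' + 1 := ⟨k - 1, by omega⟩
      exact ⟨ρ, r1, by simpa using r2, r3, k, by simpa using hk, by omega, by simpa using hk2⟩

theorem stmt18 {n d : ℕ} (V : Fin n → Fin d → ℝ) (Δ : Set (Finset (Fin n)))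
    (hΔ : IsComplex Δ)
    (col : Fin n → Fin (d + 1)) (hcol : ∀ σ ∈ Δ, Set.InjOn col ↑σ)
    (L : List (Finset (Fin n))) (hL : IsShelling Δ (d + 1) L)
    (hp : IsProper V Δ) :
    ∀ γ ∈ stress V {σ ∈ Δ | ∀ v ∈ σ, col v ≠ Fin.last d},
      ∃ g : Fin n → MvPolynomial (Fin n) ℝ,
        (∀ v, g v ∈ stress V (lk Δ {v})) ∧
        (∀ v, col v ≠ Fin.last d → g v = 0) ∧
        ∑ v, g v = γ := by
  classical
  intro γ hγ
  obtain ⟨-, hL1, hL2, hL3⟩ := hL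
  have hΔL : Δ = gen L := by
    ext σ
    exact ⟨hL2 σ, fun ⟨F, h1, h2⟩ => hΔ _ ((hL1 F).1 h1).1 _ h2⟩
  change γ ∈ stress V (cr col Δ) at hγ
  rw [mem_stress_iff V _ (cr_cplx col hΔ)] at hγ
  obtain ⟨g, g1, g2, g3, g4⟩ := (main_ind V col L (fun F hF => ((hL1 F).1 hF).2)
    (fun F hF => hcol F ((hL1 F).1 hF).1) (sh_of L hL3)
    (fun F hF G hG hc => hp G (hΔ _ ((hL1 F).1 hF).1 _ hG) hc.le)).2 (dc γ)
    (hΔL ▸ hγ.1) hγ.2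
  rw [← hΔL] at g1
  let N := γ.totalDegree
  choose p hpN using fun v => exists_trunc N (g v)
  refine ⟨p, fun v => ?_, fun v hv => ?_, ?_⟩
  · rw [mem_stress_iff V _ (lk_cplx hΔ _)]
    refine ⟨fun a ha => ?_, fun j => ?_⟩
    · rw [hpN, g1 v a ha, ite_self]
    · funext a
      have h1 := congrFun (g2 v j) a
      simp only [DD, hpN, map_add, Finsupp.degree_single] at h1 ⊢
      by_cases hN : a.degree + 1 ≤ N
      · simpa [hN] using h1
      · simp [hN]
  · apply dc_inj
    intro a
    rw [hpN, g3 v hv, dc_zero]; simp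
  · apply dc_inj
    intro a
    rw [dc_sum]
    simp only [hpN]
    have h1 := congrFun g4 a
    rw [Finset.sum_apply] at h1
    split_ifs with h
    · exact h1
    · have : coeff a γ = 0 := by
        apply coeff_eq_zero_of_totalDegree_lt
        exact not_le.1 h
      simp [dc, this]
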